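/- Let G be a vertex-minimal graph among triangle-free, fork-free graphs with chromatic number at least 4. Then G is 3-connected. -/

import Mathlib

open SimpleGraph

/-- The fork: `K_{1,4}` with two edges subdivided. Vertex 0 is the center,
adjacent to leaves 1, 2 and to 3, 5; paths 0-3-4 and 0-5-6. -/
def fork : SimpleGraph (Fin 7) :=
  SimpleGraph.fromEdgeSet {s(0, 1), s(0, 2), s(0, 3), s(0, 5), s(3, 4), s(5, 6)}

/-- A graph is fork-free if it has no induced subgraph isomorphic to the fork. -/
def ForkFree {V : Type} (G : SimpleGraph V) : Prop :=
  IsEmpty (fork ↪g G)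

/-- `G` is a vertex-minimal triangle-free, fork-free graph with chromatic
number at least 4: every smaller triangle-free fork-free graph is 3-colorable. -/
def MinCex {V : Type} [Fintype V] (G : SimpleGraph V) : Prop :=
  G.CliqueFree 3 ∧ ForkFree G ∧ 4 ≤ G.chromaticNumber ∧
    ∀ (W : Type) [Fintype W] (H : SimpleGraph W),
      Fintype.card W < Fintype.card V → H.CliqueFree 3 → ForkFree H →
        H.chromaticNumber ≤ 3

theorem MinCex.not_col {V : Type} [Fintype V] {G : SimpleGraph V} (hG : MinCex G)
    (c : V → Fin 3) (hc : ∀ x y, G.Adj x y → c x ≠ c y) : False := by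
  have h : G.Colorable 3 := ⟨SimpleGraph.Coloring.mk c (fun {x y} h => hc x y h)⟩
  have h1 := h.chromaticNumber_le
  have h2 := hG.2.2.1.trans h1
  exact absurd h2 (by decide)

theorem MinCex.col_del {V : Type} [Fintype V] {G : SimpleGraph V} (hG : MinCex G) (v : V) :
    ∃ c : V → Fin 3, ∀ x y, x ≠ v → y ≠ v → G.Adj x y → c x ≠ c y := by
  classical
  obtain ⟨h1, h2, -, h4⟩ := hG
  have h := h4 {x : V // x ≠ v} (G.induce {x : V | x ≠ v})
    (Fintype.card_subtype_lt (x := v) (by simp))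
    (h1.comap ⟨(SimpleGraph.Embedding.induce _).toCopy⟩)
    ⟨fun e => h2.false (e.trans (SimpleGraph.Embedding.induce _))⟩
  have hcol : (G.induce {x : V | x ≠ v}).Colorable 3 :=
    SimpleGraph.chromaticNumber_le_iff_colorable.1 h
  obtain ⟨c⟩ := hcol
  refine ⟨fun x => if hx : x ≠ v then c ⟨x, hx⟩ else 0, fun x y hx hy hxy => ?_⟩
  simp only [dif_pos hx, dif_pos hy]
  exact c.valid (v := ⟨x, hx⟩) (w := ⟨y, hy⟩) hxy

theorem MinCex.no_tri {V : Type} [Fintype V] {G : SimpleGraph V} (hG : MinCex G) (x y z : V)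
    (h1 : G.Adj x y) (h2 : G.Adj x z) (h3 : G.Adj y z) : False := by
  classical
  exact hG.1 {x, y, z} (SimpleGraph.is3Clique_triple_iff.2 ⟨h1, h2, h3⟩)

/-- No neighbourhood contains another one. -/
theorem MinCex.priv {V : Type} [Fintype V] {G : SimpleGraph V} (hG : MinCex G) (x y : V)
    (hxy : x ≠ y) : ∃ z, G.Adj x z ∧ ¬ G.Adj y z := by
  classical
  by_contra! h
  obtain ⟨c, hc⟩ := hG.col_del x
  refine hG.not_col (fun z => if z = x then c y else c z) fun p q hpq => ?_
  have hne := hpq.ne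
  by_cases hp : p = x
  · subst hp
    simp only [if_true, if_neg hne.symm]
    exact hc _ _ hxy.symm hne.symm (h q hpq)
  · by_cases hq : q = x
    · subst hq
      simp only [if_true, if_neg hp]
      exact (hc _ _ hxy.symm hp (h p hpq.symm)).symm
    · simp only [if_neg hp, if_neg hq]
      exact hc _ _ hp hq hpq

theorem fork_build {V : Type} {G : SimpleGraph V} (hF : ForkFree G) (u p q a a' b b' : V)
    (hpq : p ≠ q) (h01 : G.Adj u p) (h02 : G.Adj u q) (h03 : G.Adj u a) (h05 : G.Adj u b)
    (h34 : G.Adj a a') (h56 : G.Adj b b')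
    (n04 : ¬ G.Adj u a') (n06 : ¬ G.Adj u b')
    (n12 : ¬ G.Adj p q) (n13 : ¬ G.Adj p a) (n14 : ¬ G.Adj p a') (n15 : ¬ G.Adj p b)
    (n16 : ¬ G.Adj p b') (n23 : ¬ G.Adj q a) (n24 : ¬ G.Adj q a') (n25 : ¬ G.Adj q b)
    (n26 : ¬ G.Adj q b') (n35 : ¬ G.Adj a b) (n36 : ¬ G.Adj a b') (n45 : ¬ G.Adj a' b)
    (n46 : ¬ G.Adj a' b') : False := by
  have key : ∀ i j, G.Adj (![u, p, q, a, a', b, b'] i) (![u, p, q, a, a', b, b'] j) ↔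
      fork.Adj i j := by
    intro i j
    fin_cases i <;> fin_cases j <;>
      simp [fork, SimpleGraph.fromEdgeSet_adj, *, G.adj_comm q p, G.adj_comm p u, G.adj_comm q u,
        G.adj_comm a u, G.adj_comm a' u, G.adj_comm b u, G.adj_comm b' u, G.adj_comm a p,
        G.adj_comm a' p, G.adj_comm b p, G.adj_comm b' p, G.adj_comm a q,
        G.adj_comm a' q, G.adj_comm b q, G.adj_comm b' q, G.adj_comm a' a, G.adj_comm b a,
        G.adj_comm b' a, G.adj_comm b a', G.adj_comm b' a', G.adj_comm b' b]
  have twin : ∀ i j : Fin 7, (∀ k, fork.Adj i k ↔ fork.Adj j k) →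
      i = j ∨ (i = 1 ∧ j = 2) ∨ (i = 2 ∧ j = 1) := by
    have : DecidableRel fork.Adj := by
      unfold fork
      infer_instance
    simp only [fork, SimpleGraph.fromEdgeSet_adj, Set.mem_insert_iff, Set.mem_singleton_iff]
    decide
  refine hF.false ⟨⟨![u, p, q, a, a', b, b'], fun i j hij => ?_⟩, fun {i j} => key i j⟩
  rcases twin i j fun k => by rw [← key, ← key, hij] with h | ⟨rfl, rfl⟩ | ⟨rfl, rfl⟩
  · exact h
  · exact absurd hij hpq
  · exact absurd hij hpq.symm

theorem perm_three : ∀ a b c d : Fin 3, (a = b ↔ c = d) →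
    ∃ σ : Equiv.Perm (Fin 3), σ c = a ∧ σ d = b := by
  decide

/-- `c` is a proper colouring of the part of `G` off `A`. -/
def ColOff {V : Type} (G : SimpleGraph V) (A : Set V) (c : V → Fin 3) : Prop :=
  ∀ x y, x ∉ A → y ∉ A → G.Adj x y → c x ≠ c y

structure CutSep {V : Type} (G : SimpleGraph V) (A B : Set V) (u w : V) : Prop where
  cover : ∀ x, x ∈ A ∨ x ∈ B ∨ x = u ∨ x = w
  disj : ∀ x, x ∈ A → x ∉ B
  uA : u ∉ A
  uB : u ∉ B
  wA : w ∉ A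
  wB : w ∉ B
  no : ∀ x y, x ∈ A → y ∈ B → ¬ G.Adj x y

theorem CutSep.symm {V : Type} {G : SimpleGraph V} {A B : Set V} {u w : V} (h : CutSep G A B u w) :
    CutSep G B A u w :=
  ⟨fun x => by have := h.cover x; tauto, fun x hB hA => h.disj x hA hB, h.uB, h.uA, h.wB, h.wA,
    fun x y hx hy hxy => h.no y x hy hx hxy.symm⟩

theorem CutSep.swap {V : Type} {G : SimpleGraph V} {A B : Set V} {u w : V} (h : CutSep G A B u w) :
    CutSep G A B w u :=
  ⟨fun x => by have := h.cover x; tauto, h.disj, h.wA, h.wB, h.uA, h.uB, h.no⟩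

theorem CutSep.glue {V : Type} [Fintype V] {G : SimpleGraph V} (hG : MinCex G) {A B : Set V} {u w : V}
    (h : CutSep G A B u w) (c d : V → Fin 3) (hc : ColOff G B c) (hd : ColOff G A d)
    (hcd : c u = c w ↔ d u = d w) : False := by
  classical
  obtain ⟨σ, hu, hw⟩ := perm_three _ _ _ _ hcd
  have e1 : ∀ x, x ∉ B → (if x ∈ B then σ (d x) else c x) = c x := fun x hx => if_neg hx
  have e2 : ∀ x, x ∉ A → (if x ∈ B then σ (d x) else c x) = σ (d x) := by
    intro x hx
    split_ifs with hB
    · rfl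
    · rcases h.cover x with h | h | rfl | rfl
      · exact absurd h hx
      · exact absurd h hB
      · exact hu.symm
      · exact hw.symm
  refine hG.not_col (fun x => if x ∈ B then σ (d x) else c x) fun x y hxy => ?_
  have hor : (x ∉ B ∧ y ∉ B) ∨ (x ∉ A ∧ y ∉ A) := by
    by_contra hcon
    have hx := h.no x y
    have hy := h.no y x
    have hxy' := hxy.symm
    have := h.disj x
    have := h.disj y
    tauto
  rcases hor with ⟨hx, hy⟩ | ⟨hx, hy⟩
  · simp only [e1 x hx, e1 y hy]
    exact hc x y hx hy hxy
  · simp only [e2 x hx, e2 y hy]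
    exact fun he => hd x y hx hy hxy (σ.injective he)

theorem exists_third : ∀ a b : Fin 3, ∃ c : Fin 3, c ≠ a ∧ c ≠ b := by decide

/-- If every colouring of the side `A` identifies `u, w`, then `u` has two neighbours in `A`. -/
theorem CutSep.two {V : Type} [Fintype V] {G : SimpleGraph V} {A B : Set V} {u w : V}
    (h : CutSep G A B u w) (huw : u ≠ w) (hadj : ¬ G.Adj u w)
    (c : V → Fin 3) (hc : ColOff G B c) (hno : ∀ c, ColOff G B c → c u = c w) :
    ∃ x y, x ∈ A ∧ y ∈ A ∧ x ≠ y ∧ G.Adj u x ∧ G.Adj u y := by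
  classical
  by_contra! hcon
  have : ∃ k : Fin 3, k ≠ c w ∧ ∀ x, x ∈ A → G.Adj u x → k ≠ c x := by
    by_cases hx : ∃ x, x ∈ A ∧ G.Adj u x
    · obtain ⟨x, hxA, hux⟩ := hx
      obtain ⟨k, h1, h2⟩ := exists_third (c w) (c x)
      refine ⟨k, h1, fun y hy huy => ?_⟩
      by_cases hxy : x = y
      · exact hxy ▸ h2
      · exact absurd huy (hcon x y hxA hy hxy hux)
    · obtain ⟨k, h1, h2⟩ := exists_third (c w) (c w)
      exact ⟨k, h1, fun y hy huy => absurd ⟨y, hy, huy⟩ hx⟩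
  obtain ⟨k, hk, hk'⟩ := this
  have hn : ∀ y, y ∉ B → G.Adj u y → k ≠ c y := by
    intro y hy huy
    rcases h.cover y with h | h | rfl | rfl
    · exact hk' y h huy
    · exact absurd h hy
    · exact absurd huy (G.loopless.irrefl _)
    · exact absurd huy hadj
  have := hno (Function.update c u k) (by
    intro x y hx hy hxy
    by_cases hxu : x = u
    · subst hxu
      rw [Function.update_self, Function.update_of_ne hxy.ne.symm]
      exact hn y hy hxy
    · by_cases hyu : y = u
      · subst hyu
        rw [Function.update_self, Function.update_of_ne hxu]
        exact (hn x hx hxy.symm).symm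
      · rw [Function.update_of_ne hxu, Function.update_of_ne hyu]
        exact hc x y hx hy hxy)
  rw [Function.update_self, Function.update_of_ne huw.symm] at this
  exact hk this

/-- Two neighbours on each side yield a fork. -/
theorem CutSep.fork {V : Type} [Fintype V] {G : SimpleGraph V} (hG : MinCex G) {A B : Set V} {u w : V}
    (h : CutSep G A B u w)
    (hA : ∃ x y, x ∈ A ∧ y ∈ A ∧ x ≠ y ∧ G.Adj u x ∧ G.Adj u y)
    (hB : ∃ x y, x ∈ B ∧ y ∈ B ∧ x ≠ y ∧ G.Adj u x ∧ G.Adj u y) : False := by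
  have gen : ∀ {A B : Set V}, CutSep G A B u w →
      (∃ x y, x ∈ A ∧ y ∈ A ∧ x ≠ y ∧ G.Adj u x ∧ G.Adj u y) →
      ∃ x y z, x ∈ A ∧ y ∈ A ∧ z ∈ A ∧ G.Adj u x ∧ G.Adj u y ∧ G.Adj x z ∧ ¬ G.Adj y z := by
    rintro A B h ⟨x, y, hx, hy, hxy, hux, huy⟩
    obtain ⟨z, hz, hz'⟩ := hG.priv x y hxy
    obtain ⟨t, ht, ht'⟩ := hG.priv y x hxy.symm
    by_cases hzA : z ∈ A
    · exact ⟨x, y, z, hx, hy, hzA, hux, huy, hz, hz'⟩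
    by_cases htA : t ∈ A
    · exact ⟨y, x, t, hy, hx, htA, huy, hux, ht, ht'⟩
    exfalso
    have hzw : z = w := by
      rcases h.cover z with h1 | h1 | h1 | h1
      · exact absurd h1 hzA
      · exact absurd hz (h.no _ _ hx h1)
      · exact absurd (h1 ▸ huy.symm) hz'
      · exact h1
    have htw : t = w := by
      rcases h.cover t with h1 | h1 | h1 | h1
      · exact absurd h1 htA
      · exact absurd ht (h.no _ _ hy h1)
      · exact absurd (h1 ▸ hux.symm) ht'
      · exact h1
    subst hzw
    subst htw
    exact hz' ht
  obtain ⟨a, p, a', ha, hp, ha', hua, hup, haa, hpa⟩ := gen h hA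
  obtain ⟨b, q, b', hb, hq, hb', hub, huq, hbb, hqb⟩ := gen h.symm hB
  refine fork_build hG.2.1 u p q a a' b b' (fun e => h.disj p hp (e ▸ hq)) hup huq hua hub haa hbb
    (fun e => hG.no_tri u a a' hua e haa) (fun e => hG.no_tri u b b' hub e hbb)
    (h.no _ _ hp hq) (fun e => hG.no_tri u p a hup hua e) hpa (h.no _ _ hp hb) (h.no _ _ hp hb')
    (h.symm.no _ _ hq ha) (h.symm.no _ _ hq ha') (fun e => hG.no_tri u q b huq hub e) hqb
    (h.no _ _ ha hb) (h.no _ _ ha hb') (h.no _ _ ha' hb) (h.no _ _ ha' hb')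

/-- If no colouring of the side `B` identifies `u, w`, one of them has two neighbours in `B`. -/
theorem CutSep.two_or {V : Type} [Fintype V] {G : SimpleGraph V} {A B : Set V} {u w : V}
    (h : CutSep G A B u w) (hadj : ¬ G.Adj u w)
    (d : V → Fin 3) (hd : ColOff G A d) (hno : ∀ d, ColOff G A d → d u ≠ d w) :
    (∃ x y, x ∈ B ∧ y ∈ B ∧ x ≠ y ∧ G.Adj u x ∧ G.Adj u y) ∨
    (∃ x y, x ∈ B ∧ y ∈ B ∧ x ≠ y ∧ G.Adj w x ∧ G.Adj w y) := by
  classical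
  by_contra! hcon
  obtain ⟨h1, h2⟩ := hcon
  have one : ∀ v, (∀ x y, x ∈ B → y ∈ B → x ≠ y → G.Adj v x → ¬ G.Adj v y) →
      ∃ a : Fin 3, ∀ y, y ∈ B → G.Adj v y → d y = a := by
    intro v hv
    by_cases hx : ∃ x, x ∈ B ∧ G.Adj v x
    · obtain ⟨x, hxB, hvx⟩ := hx
      refine ⟨d x, fun y hy hvy => ?_⟩
      by_cases hxy : x = y
      · rw [hxy]
      · exact absurd hvy (hv x y hxB hy hxy hvx)
    · exact ⟨0, fun y hy hvy => absurd ⟨y, hy, hvy⟩ hx⟩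
  obtain ⟨a, ha⟩ := one u h1
  obtain ⟨b, hb⟩ := one w h2
  obtain ⟨k, hka, hkb⟩ := exists_third a b
  have hB : ∀ x, x ∉ A → x ∈ B ∨ (x = u ∨ x = w) := by
    intro x hx
    have := h.cover x
    tauto
  have hBn : ∀ x, x ∈ B → ¬ (x = u ∨ x = w) := by
    rintro x hx (rfl | rfl)
    · exact h.uB hx
    · exact h.wB hx
  have hn : ∀ x y, (x = u ∨ x = w) → y ∈ B → G.Adj x y → k ≠ d y := by
    rintro x y (rfl | rfl) hy hxy
    · rw [ha y hy hxy]; exact hka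
    · rw [hb y hy hxy]; exact hkb
  refine hno (fun x => if x = u ∨ x = w then k else d x) ?_ (by simp)
  intro x y hx hy hxy
  rcases hB x hx with hx' | hx' <;> rcases hB y hy with hy' | hy'
  · simp only [if_neg (hBn x hx'), if_neg (hBn y hy')]
    exact hd x y hx hy hxy
  · simp only [if_neg (hBn x hx'), if_pos hy']
    exact (hn y x hy' hx' hxy.symm).symm
  · simp only [if_neg (hBn y hy'), if_pos hx']
    exact hn x y hx' hy' hxy
  · exfalso
    rcases hx' with rfl | rfl <;> rcases hy' with rfl | rfl
    · exact hxy.ne rfl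
    · exact hadj hxy
    · exact hadj hxy.symm
    · exact hxy.ne rfl

theorem CutSep.contra_aux {V : Type} [Fintype V] {G : SimpleGraph V} (hG : MinCex G) {A B : Set V}
    {u w : V} (h : CutSep G A B u w) (huw : u ≠ w) (hadj : ¬ G.Adj u w)
    (c d : V → Fin 3) (hc : ColOff G B c) (hd : ColOff G A d) (h1 : c u = c w) (h2 : d u ≠ d w) :
    False := by
  have hsame : ∀ c, ColOff G B c → c u = c w := by
    intro c' hc'
    by_contra hne
    exact h.glue hG c' d hc' hd (iff_of_false hne h2)
  have hdiff : ∀ d, ColOff G A d → d u ≠ d w := fun d' hd' he =>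
    h.glue hG c d' hc hd' (iff_of_true h1 he)
  rcases h.two_or hadj d hd hdiff with hB | hB
  · exact h.fork hG (h.two huw hadj c hc hsame) hB
  · exact h.swap.fork hG (h.swap.two huw.symm (fun e => hadj e.symm) c hc
      (fun c hc => (hsame c hc).symm)) hB

theorem CutSep.contra {V : Type} [Fintype V] {G : SimpleGraph V} (hG : MinCex G) {A B : Set V}
    {u w : V} (h : CutSep G A B u w) (hA : A.Nonempty) (hB : B.Nonempty) : False := by
  obtain ⟨a, ha⟩ := hA
  obtain ⟨b, hb⟩ := hB
  obtain ⟨c, hc⟩ := hG.col_del b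
  obtain ⟨d, hd⟩ := hG.col_del a
  replace hc : ColOff G B c := fun x y hx hy =>
    hc x y (fun e => hx (e ▸ hb)) (fun e => hy (e ▸ hb))
  replace hd : ColOff G A d := fun x y hx hy =>
    hd x y (fun e => hx (e ▸ ha)) (fun e => hy (e ▸ ha))
  by_cases huw : u = w
  · exact h.glue hG c d hc hd (by simp [huw])
  by_cases hadj : G.Adj u w
  · exact h.glue hG c d hc hd
      (iff_of_false (hc u w h.uB h.wB hadj) (hd u w h.uA h.wA hadj))
  by_cases h1 : c u = c w <;> by_cases h2 : d u = d w
  · exact h.glue hG c d hc hd (iff_of_true h1 h2)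
  · exact h.contra_aux hG huw hadj c d hc hd h1 h2
  · exact h.symm.contra_aux hG huw hadj d c hd hc h2 h1
  · exact h.glue hG c d hc hd (iff_of_false h1 h2)

theorem minCex_three_connected {V : Type} [Fintype V]
    (G : SimpleGraph V) (hG : MinCex G) :
    4 ≤ Fintype.card V ∧
      ∀ u w : V, (G.induce {x : V | x ≠ u ∧ x ≠ w}).Connected := by
  classical
  have hcard : 4 ≤ Fintype.card V := by
    by_contra hlt
    have hle : Fintype.card V ≤ Fintype.card (Fin 3) := by
      rw [Fintype.card_fin]; omega
    obtain ⟨f⟩ := Function.Embedding.nonempty_of_card_le hle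
    exact hG.not_col f fun x y hxy he => hxy.ne (f.injective he)
  refine ⟨hcard, fun u w => ?_⟩
  have hne : Nonempty {x : V | x ≠ u ∧ x ≠ w} := by
    by_contra hcon
    have hsub : (Finset.univ : Finset V) ⊆ {u, w} := by
      intro x _
      by_contra hx
      exact hcon ⟨⟨x, by simpa using hx⟩⟩
    have h1 := Finset.card_le_card hsub
    have h2 := Finset.card_le_two (a := u) (b := w)
    rw [Finset.card_univ] at h1
    omega
  refine (SimpleGraph.connected_iff _).2 ⟨fun x y => ?_, hne⟩
  by_contra hxy
  let H := G.induce {x : V | x ≠ u ∧ x ≠ w}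
  refine CutSep.contra hG (u := u) (w := w)
    (A := {v | ∃ h : v ≠ u ∧ v ≠ w, H.Reachable x ⟨v, h⟩})
    (B := {v | ∃ h : v ≠ u ∧ v ≠ w, ¬ H.Reachable x ⟨v, h⟩}) ?_
    ⟨x, x.2, SimpleGraph.Reachable.refl _⟩ ⟨y, y.2, hxy⟩
  refine ⟨fun v => ?_, ?_, ?_, ?_, ?_, ?_, ?_⟩
  · by_cases h : v ≠ u ∧ v ≠ w
    · by_cases h' : H.Reachable x ⟨v, h⟩
      · exact Or.inl ⟨h, h'⟩
      · exact Or.inr (Or.inl ⟨h, h'⟩)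
    · right; right; tauto
  · rintro v ⟨_, h⟩ ⟨_, h'⟩
    exact h' h
  · rintro ⟨h, _⟩; exact h.1 rfl
  · rintro ⟨h, _⟩; exact h.1 rfl
  · rintro ⟨h, _⟩; exact h.2 rfl
  · rintro ⟨h, _⟩; exact h.2 rfl
  · rintro p q ⟨hp, hp'⟩ ⟨hq, hq'⟩ hpq
    refine hq' (hp'.trans (SimpleGraph.Adj.reachable ?_))
    exact hpq
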